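/- arXiv:math/0307144 — 2 statements merged into one kernel-verified Lean document; each statement's English description precedes it below -/
import Mathlib

section
/- Let N ≥ 3, ρ > 0, let K and K' be cones in ℝ^N with K' nonempty and with (closure of K') ∖ {0} ⊆ K, and let V : ℝ^N → ℝ satisfy V(x) ≥ 0 for all x ∈ K with ‖x‖ > ρ, and ‖x‖²·V(x) → ∞ as ‖x‖ → ∞ with x ∈ K'. Then there is no function u : ℝ^N → ℝ which is C² on K ∩ {x : ‖x‖ > ρ}, positive there, and satisfies -Δu(x) ≥ V(x)·u(x) for all x ∈ K with ‖x‖ > ρ. (The paper's Nonexistence Lemma 2.7 for the Laplacian on a cone-like domain: the equation -Δu - Vu = 0 has no positive supersolutions at infinity in K when |x|²V(x) → ∞ along a subcone.) -/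
open scoped Pointwise

/-- The Laplacian of `u : ℝ^N → ℝ`: the sum of its second partial derivatives. -/
noncomputable def lap {N : ℕ} (u : EuclideanSpace ℝ (Fin N) → ℝ)
    (x : EuclideanSpace ℝ (Fin N)) : ℝ :=
  ∑ i, fderiv ℝ (fun y => fderiv ℝ u y (EuclideanSpace.single i 1)) x (EuclideanSpace.single i 1)

/-- Second-order necessary condition at a local minimum on the line. -/
theorem IsLocalMin.deriv_deriv_nonneg {f : ℝ → ℝ} {a : ℝ} (h : IsLocalMin f a)
    (hf : ContinuousAt f a) : 0 ≤ deriv (deriv f) a := by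
  by_contra! hneg
  have hmax : IsLocalMax f a :=
    isLocalMax_of_deriv_deriv_neg hneg h.deriv_eq_zero hf
  have hconst : f =ᶠ[nhds a] fun _ => f a := by
    filter_upwards [h, hmax] with x h₁ h₂ using le_antisymm h₂ h₁
  have hzero : deriv (deriv f) a = 0 := by
    rw [hconst.deriv.deriv_eq]
    simp
  exact hneg.ne hzero

section SecondDerivative

variable {E : Type*} [NormedAddCommGroup E] [NormedSpace ℝ E]

theorem ContDiffAt.differentiableAt_fderiv_apply {f : E → ℝ} {p : E} (hf : ContDiffAt ℝ 2 f p)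
    (v : E) : DifferentiableAt ℝ (fun y => fderiv ℝ f y v) p :=
  ((hf.fderiv_right (m := 1) (by norm_num)).differentiableAt one_ne_zero).clm_apply
    (differentiableAt_const v)

theorem ContDiffAt.eventually_differentiableAt {f : E → ℝ} {p : E} (hf : ContDiffAt ℝ 2 f p) :
    ∀ᶠ y in nhds p, DifferentiableAt ℝ f y := by
  filter_upwards [hf.eventually (by simp)] with y hy using hy.differentiableAt two_ne_zero

/-- At a local minimum, second directional derivatives are nonnegative. -/
theorem IsLocalMin.fderiv_fderiv_apply_nonneg {f : E → ℝ} {p : E} (h : IsLocalMin f p)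
    (hf : ContDiffAt ℝ 2 f p) (v : E) : 0 ≤ fderiv ℝ (fun y => fderiv ℝ f y v) p v := by
  have hline : ∀ t : ℝ, HasDerivAt (fun s : ℝ => p + s • v) v t := fun t => by
    simpa using ((hasDerivAt_id t).smul_const v).const_add p
  have hzero : p + (0 : ℝ) • v = p := by simp
  have hcont : Filter.Tendsto (fun s : ℝ => p + s • v) (nhds 0) (nhds p) := by
    simpa using (hline 0).continuousAt.tendsto
  have hderiv : deriv (fun s : ℝ => f (p + s • v)) =ᶠ[nhds 0]
      fun s => fderiv ℝ f (p + s • v) v := by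
    filter_upwards [hcont.eventually hf.eventually_differentiableAt] with s hs
    exact (hs.hasFDerivAt.comp_hasDerivAt s (hline s)).deriv
  have hderiv₂ : deriv (deriv fun s : ℝ => f (p + s • v)) 0 =
      fderiv ℝ (fun y => fderiv ℝ f y v) p v := by
    rw [hderiv.deriv_eq]
    have hd := (hf.differentiableAt_fderiv_apply v).hasFDerivAt
    rw [← hzero] at hd
    have := (hd.comp_hasDerivAt 0 (hline 0)).deriv
    simpa [Function.comp_def] using this
  rw [← hderiv₂]
  refine IsLocalMin.deriv_deriv_nonneg ?_ ?_
  · have := hcont.eventually h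
    simpa [IsLocalMin, IsMinFilter] using this
  · exact ContinuousAt.comp (by simpa using hf.continuousAt) (hline 0).continuousAt

theorem fderiv_fderiv_const_mul_sub_apply {f g : E → ℝ} {p : E} (hf : ContDiffAt ℝ 2 f p)
    (hg : ContDiffAt ℝ 2 g p) (c : ℝ) (v : E) :
    fderiv ℝ (fun y => fderiv ℝ (fun z => c * f z - g z) y v) p v =
      c * fderiv ℝ (fun y => fderiv ℝ f y v) p v - fderiv ℝ (fun y => fderiv ℝ g y v) p v := by
  have hfst : (fun y => fderiv ℝ (fun z => c * f z - g z) y v) =ᶠ[nhds p]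
      fun y => c * fderiv ℝ f y v - fderiv ℝ g y v := by
    filter_upwards [hf.eventually_differentiableAt, hg.eventually_differentiableAt] with y hy₁ hy₂
    rw [((hy₁.hasFDerivAt.const_mul c).fun_sub hy₂.hasFDerivAt).fderiv]
    simp
  rw [hfst.fderiv_eq, (((hf.differentiableAt_fderiv_apply v).hasFDerivAt.const_mul c).fun_sub
    (hg.differentiableAt_fderiv_apply v).hasFDerivAt).fderiv]
  simp

end SecondDerivative

theorem lap_const_mul_sub {N : ℕ} {f g : EuclideanSpace ℝ (Fin N) → ℝ}
    {p : EuclideanSpace ℝ (Fin N)} (hf : ContDiffAt ℝ 2 f p) (hg : ContDiffAt ℝ 2 g p) (c : ℝ) :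
    lap (fun y => c * f y - g y) p = c * lap f p - lap g p := by
  simp only [lap, fderiv_fderiv_const_mul_sub_apply hf hg, Finset.sum_sub_distrib, Finset.mul_sum]

theorem IsLocalMin.lap_nonneg {N : ℕ} {f : EuclideanSpace ℝ (Fin N) → ℝ}
    {p : EuclideanSpace ℝ (Fin N)} (h : IsLocalMin f p) (hf : ContDiffAt ℝ 2 f p) :
    0 ≤ lap f p :=
  Finset.sum_nonneg fun _ _ => h.fderiv_fderiv_apply_nonneg hf _

theorem lap_sq_sub_norm_sq_sq {N : ℕ} (x₀ p : EuclideanSpace ℝ (Fin N)) (R : ℝ) :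
    lap (fun y => (R ^ 2 - ‖y - x₀‖ ^ 2) ^ 2) p =
      8 * ‖p - x₀‖ ^ 2 - 4 * N * (R ^ 2 - ‖p - x₀‖ ^ 2) := by
  have hw : ∀ y : EuclideanSpace ℝ (Fin N),
      HasFDerivAt (fun y : EuclideanSpace ℝ (Fin N) => R ^ 2 - ‖y - x₀‖ ^ 2)
        (-(2 • innerSL ℝ (y - x₀))) y := fun y => by
    simpa using (((hasFDerivAt_id y).sub_const x₀).norm_sq).const_sub (R ^ 2)
  have hfst : ∀ (i : Fin N) (y : EuclideanSpace ℝ (Fin N)),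
      fderiv ℝ (fun y => (R ^ 2 - ‖y - x₀‖ ^ 2) ^ 2) y (EuclideanSpace.single i 1) =
        -4 * ((R ^ 2 - ‖y - x₀‖ ^ 2) * (y i - x₀ i)) := fun i y => by
    rw [((hw y).pow 2).fderiv]
    simp [EuclideanSpace.inner_single_right]
    ring
  have hcoord : ∀ i : Fin N, HasFDerivAt (fun y : EuclideanSpace ℝ (Fin N) => y i - x₀ i)
      (EuclideanSpace.proj i : EuclideanSpace ℝ (Fin N) →L[ℝ] ℝ) p := fun i =>
    (EuclideanSpace.proj i : EuclideanSpace ℝ (Fin N) →L[ℝ] ℝ).hasFDerivAt.sub_const (x₀ i)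
  have hsnd : ∀ i : Fin N,
      fderiv ℝ (fun y : EuclideanSpace ℝ (Fin N) => -4 * ((R ^ 2 - ‖y - x₀‖ ^ 2) * (y i - x₀ i)))
        p (EuclideanSpace.single i 1) =
        8 * (p i - x₀ i) ^ 2 - 4 * (R ^ 2 - ‖p - x₀‖ ^ 2) := fun i => by
    rw [(((hw p).fun_mul (hcoord i)).const_mul (-4)).fderiv]
    simp [EuclideanSpace.inner_single_right]
    ring
  simp only [lap, hfst, hsnd, Finset.sum_sub_distrib, ← Finset.mul_sum]
  have hnorm : ‖p - x₀‖ ^ 2 = ∑ i, (p i - x₀ i) ^ 2 := by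
    simp [EuclideanSpace.real_norm_sq_eq]
  simp [hnorm]
  ring

/-- If `μ R²` is large, a ball of radius `R` carries no positive supersolution of
`-Δu = μ u`: compare with `(R² - ‖x - x₀‖²)²` at the point where the quotient is maximal. -/
theorem not_positive_supersolution_closedBall {N : ℕ} {x₀ : EuclideanSpace ℝ (Fin N)} {R μ : ℝ}
    (hR : 0 < R) (hμ : (4 * N + 8 : ℝ) ^ 2 < 32 * (μ * R ^ 2))
    {u : EuclideanSpace ℝ (Fin N) → ℝ}
    (hu : ∀ x ∈ Metric.closedBall x₀ R, ContDiffAt ℝ 2 u x)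
    (hpos : ∀ x ∈ Metric.closedBall x₀ R, 0 < u x) :
    ∃ x ∈ Metric.closedBall x₀ R, -lap u x < μ * u x := by
  by_contra! hsuper
  set φ : EuclideanSpace ℝ (Fin N) → ℝ := fun y => (R ^ 2 - ‖y - x₀‖ ^ 2) ^ 2 with hφ
  have hφC : ContDiff ℝ 2 φ :=
    (contDiff_const.sub ((contDiff_id.sub contDiff_const).norm_sq ℝ)).pow 2
  have hx₀ : x₀ ∈ Metric.closedBall x₀ R := Metric.mem_closedBall_self hR.le
  obtain ⟨p, hp, hmax⟩ := (isCompact_closedBall x₀ R).exists_isMaxOn ⟨x₀, hx₀⟩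
    (f := fun x => φ x / u x) (hφC.continuous.continuousOn.div
      (fun x hx => (hu x hx).continuousAt.continuousWithinAt) fun x hx => (hpos x hx).ne')
  set c := φ p / u p with hc
  have hcpos : 0 < c := by
    refine lt_of_lt_of_le (div_pos ?_ (hpos x₀ hx₀)) (hmax hx₀)
    simp only [hφ, sub_self, norm_zero, ne_eq, OfNat.ofNat_ne_zero, not_false_eq_true, zero_pow,
      sub_zero]
    positivity
  have hcp : c * u p = φ p := div_mul_cancel₀ _ (hpos p hp).ne'
  have hφp : 0 < φ p := hcp ▸ mul_pos hcpos (hpos p hp)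
  have hpR : ‖p - x₀‖ < R := by
    refine lt_of_le_of_ne (mem_closedBall_iff_norm.1 hp) fun h => ?_
    simp [hφ, h] at hφp
  have hmin : IsLocalMin (fun y => c * u y - φ y) p := by
    filter_upwards [Metric.isOpen_ball.mem_nhds (mem_ball_iff_norm.2 hpR)] with y hy
    have hy' := Metric.ball_subset_closedBall hy
    have : φ y ≤ c * u y := (div_le_iff₀ (hpos y hy')).1 (hmax hy')
    linarith
  have hlap := hmin.lap_nonneg ((contDiffAt_const.mul (hu p hp)).sub hφC.contDiffAt)
  rw [lap_const_mul_sub (hu p hp) hφC.contDiffAt, lap_sq_sub_norm_sq_sq] at hlap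
  have hcμ := mul_le_mul_of_nonneg_left (hsuper p hp) hcpos.le
  have hquad : μ * (R ^ 2 - ‖p - x₀‖ ^ 2) ^ 2 - (4 * N + 8) * (R ^ 2 - ‖p - x₀‖ ^ 2)
      + 8 * R ^ 2 ≤ 0 := by
    have : μ * φ p ≤ -(c * lap u p) := by rw [← hcp]; linarith
    simp only [hφ] at this
    linarith
  have hμpos : 0 < μ := by
    by_contra! h
    nlinarith [mul_nonneg (neg_nonneg.2 h) (sq_nonneg R), sq_nonneg (4 * N + 8 : ℝ)]
  nlinarith [mul_le_mul_of_nonneg_left hquad hμpos.le,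
    sq_nonneg (2 * μ * (R ^ 2 - ‖p - x₀‖ ^ 2) - (4 * N + 8))]

/-- Nonexistence Lemma on cone-like domains: if `V ≥ 0` on `K ∩ {‖x‖ > ρ}` and
`‖x‖²V(x) → ∞` as `‖x‖ → ∞` along a subcone `K'` with `closure K' ∖ {0} ⊆ K`, then
`-Δu - Vu = 0` has no positive supersolution on `K ∩ {‖x‖ > ρ}`. -/
theorem nonexistence_lemma_cone
    (N : ℕ) (hN : 3 ≤ N) (ρ : ℝ) (hρ : 0 < ρ)
    (K K' : Set (EuclideanSpace ℝ (Fin N)))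
    (hKopen : IsOpen K) (hK0 : K ⊆ {x | x ≠ 0}) (hKcone : ∀ t : ℝ, 0 < t → t • K = K)
    (hK'open : IsOpen K') (hK'0 : K' ⊆ {x | x ≠ 0}) (hK'cone : ∀ t : ℝ, 0 < t → t • K' = K')
    (hK'ne : K'.Nonempty) (hK'K : closure K' \ {0} ⊆ K)
    (V : EuclideanSpace ℝ (Fin N) → ℝ)
    (hV0 : ∀ x ∈ K, ρ < ‖x‖ → 0 ≤ V x)
    (hVinf : ∀ M : ℝ, ∃ R : ℝ, ∀ x ∈ K', R < ‖x‖ → M < ‖x‖ ^ 2 * V x) :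
    ¬ ∃ u : EuclideanSpace ℝ (Fin N) → ℝ,
        ContDiffOn ℝ 2 u {x | x ∈ K ∧ ρ < ‖x‖} ∧
        (∀ x ∈ K, ρ < ‖x‖ → 0 < u x) ∧
        (∀ x ∈ K, ρ < ‖x‖ → -lap u x ≥ V x * u x) := by
  rintro ⟨u, huC, hupos, husuper⟩
  obtain ⟨x₀, hx₀⟩ := hK'ne
  obtain ⟨r, hr, hball⟩ := Metric.nhds_basis_closedBall.mem_iff.1 (hK'open.mem_nhds hx₀)
  have hrx₀ : r < ‖x₀‖ := by
    by_contra! h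
    exact hK'0 (hball (by simpa using h : (0 : EuclideanSpace ℝ (Fin N)) ∈ _)) rfl
  have hK'sub : K' ⊆ K := fun x hx => hK'K ⟨subset_closure hx, hK'0 hx⟩
  have hgap : 0 < ‖x₀‖ - r := sub_pos.2 hrx₀
  have hsum : 0 < ‖x₀‖ + r := by positivity
  set M : ℝ := (4 * N + 8) ^ 2 * (‖x₀‖ + r) ^ 2 / r ^ 2 with hM
  have hMpos : 0 < M := by positivity
  obtain ⟨R, hR⟩ := hVinf M
  obtain ⟨t, ht⟩ := exists_gt (max 0 (max (ρ / (‖x₀‖ - r)) (R / (‖x₀‖ - r))))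
  simp only [max_lt_iff, div_lt_iff₀ hgap] at ht
  obtain ⟨ht0, htρ, htR⟩ := ht
  have hnorm : ∀ x ∈ Metric.closedBall (t • x₀) (t * r),
      t * (‖x₀‖ - r) ≤ ‖x‖ ∧ ‖x‖ ≤ t * (‖x₀‖ + r) := fun x hx => by
    rw [mem_closedBall_iff_norm] at hx
    have h := abs_le.1 ((abs_norm_sub_norm_le x (t • x₀)).trans hx)
    rw [norm_smul, Real.norm_of_nonneg ht0.le] at h
    constructor <;> linarith
  have hmem : ∀ x ∈ Metric.closedBall (t • x₀) (t * r), x ∈ K' := fun x hx => by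
    rw [← hK'cone t ht0]
    refine Set.smul_set_mono hball ?_
    rwa [smul_closedBall _ _ hr.le, Real.norm_of_nonneg ht0.le]
  have hρx : ∀ x ∈ Metric.closedBall (t • x₀) (t * r), ρ < ‖x‖ := fun x hx =>
    htρ.trans_le (hnorm x hx).1
  have hopen : IsOpen {x | x ∈ K ∧ ρ < ‖x‖} :=
    hKopen.inter (isOpen_lt continuous_const continuous_norm)
  obtain ⟨x, hx, hlt⟩ := not_positive_supersolution_closedBall (x₀ := t • x₀) (R := t * r)
    (μ := M / (t * (‖x₀‖ + r)) ^ 2) (u := u) (by positivity)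
    (by
      have : M / (t * (‖x₀‖ + r)) ^ 2 * (t * r) ^ 2 = (4 * N + 8) ^ 2 := by
        rw [hM]
        field_simp
      rw [this]
      nlinarith [show (0 : ℝ) < (4 * N + 8) ^ 2 by positivity])
    (fun x hx => huC.contDiffAt (hopen.mem_nhds ⟨hK'sub (hmem x hx), hρx x hx⟩))
    (fun x hx => hupos x (hK'sub (hmem x hx)) (hρx x hx))
  have hxK := hK'sub (hmem x hx)
  have hxρ := hρx x hx
  have hVx : M / (t * (‖x₀‖ + r)) ^ 2 ≤ V x := by
    rw [div_le_iff₀ (by positivity)]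
    have h₁ := hR x (hmem x hx) (htR.trans_le (hnorm x hx).1)
    have h₂ := mul_le_mul_of_nonneg_right
      (pow_le_pow_left₀ (norm_nonneg x) (hnorm x hx).2 2) (hV0 x hxK hxρ)
    linarith
  have h₁ := mul_le_mul_of_nonneg_right hVx (hupos x hxK hxρ).le
  linarith [husuper x hxK hxρ]
end

section
/- Let N ≥ 3 and p ∈ (1, N/(N-2)); set α := -2/(p-1) (so α < 2-N) and k := α(α+N-2)/(N-1) (so k > 0), and let A_p(x) := k·I + (1-k)·(x/‖x‖)(x/‖x‖)ᵀ for x ≠ 0. Then for every q > p, setting γ := -2/(q-1) (so α < γ < 0), one has α(α+N-2) - γ(γ+N-2) > 0, and for every c > 0 with c^{q-1} ≤ α(α+N-2) - γ(γ+N-2), the function u(x) := c·x_N·‖x‖^{γ-1} is C² and positive on C₊ and satisfies -div(A_p∇u)(x) = c·(α(α+N-2) - γ(γ+N-2))·x_N·‖x‖^{γ-3} ≥ u(x)^q > 0 for all x ∈ C₊. (Existence half of the paper's Theorem 1.4 realized on the half-space cone with the explicit matrix A_p.) -/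
/-- The divergence-form operator `div(A∇u)(x) = ∑_i ∂_i(∑_j A_{ij} ∂_j u)(x)`. -/
noncomputable def divAgrad {N : ℕ}
    (A : EuclideanSpace ℝ (Fin N) → Matrix (Fin N) (Fin N) ℝ)
    (u : EuclideanSpace ℝ (Fin N) → ℝ) (x : EuclideanSpace ℝ (Fin N)) : ℝ :=
  ∑ i, fderiv ℝ
    (fun y => ∑ j, A y i j * fderiv ℝ u y (EuclideanSpace.single j 1)) x
    (EuclideanSpace.single i 1)

/-- The matrix field `A(x) = k·I + (1-k)·(x/‖x‖)(x/‖x‖)ᵀ`. -/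
noncomputable def Amat {N : ℕ} (k : ℝ) (x : EuclideanSpace ℝ (Fin N)) :
    Matrix (Fin N) (Fin N) ℝ :=
  Matrix.of fun i j => k * (if i = j then 1 else 0) + (1 - k) * (x i * x j) / ‖x‖ ^ 2

/-- The last coordinate `x_N` of `x ∈ ℝ^N`. -/
def lastCoord {N : ℕ} (x : EuclideanSpace ℝ (Fin N)) : ℝ :=
  if h : 0 < N then x ⟨N - 1, Nat.sub_lt h Nat.one_pos⟩ else 0

/-- Away from the origin, the gradient of `‖x‖ ^ a` is `a ‖x‖ ^ (a - 2) x`. -/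
theorem hasFDerivAt_norm_rpow_of_ne_zero {E : Type*} [NormedAddCommGroup E]
    [InnerProductSpace ℝ E] {x : E} (hx : x ≠ 0) (a : ℝ) :
    HasFDerivAt (fun y : E => ‖y‖ ^ a) ((a * ‖x‖ ^ (a - 2)) • innerSL ℝ x) x := by
  have hpos : 0 < ‖x‖ := norm_pos_iff.mpr hx
  have h := (hasStrictFDerivAt_norm_sq x).hasFDerivAt.rpow_const (p := a / 2)
    (Or.inl (pow_pos hpos 2).ne')
  have key : ∀ (y : E) (b : ℝ), (‖y‖ ^ 2) ^ b = ‖y‖ ^ (2 * b) := fun y b => by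
    rw [← Real.rpow_natCast_mul (norm_nonneg y)]; norm_num
  have e : (fun y : E => ‖y‖ ^ a) = fun y => (‖y‖ ^ 2) ^ (a / 2) := by
    funext y; rw [key]; congr 1; ring
  rw [e]
  refine h.congr_fderiv ?_
  rw [key, show 2 * (a / 2 - 1) = a - 2 by ring]
  ext v
  simp
  ring

/-- The partial derivatives of `y ↦ y n * ‖y‖ ^ a` away from the origin. -/
theorem fderiv_coord_mul_norm_rpow {ι : Type*} [Fintype ι] [DecidableEq ι]
    {x : EuclideanSpace ℝ ι} (hx : x ≠ 0) (n j : ι) (c a : ℝ) :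
    fderiv ℝ (fun y : EuclideanSpace ℝ ι => c * y n * ‖y‖ ^ a) x (EuclideanSpace.single j 1)
      = c * ((if n = j then ‖x‖ ^ a else 0) + a * ‖x‖ ^ (a - 2) * x n * x j) := by
  have h1 := (((EuclideanSpace.proj n : EuclideanSpace ℝ ι →L[ℝ] ℝ).hasFDerivAt
    (x := x)).const_mul c).mul (hasFDerivAt_norm_rpow_of_ne_zero hx a)
  rw [HasFDerivAt.fderiv (f := fun y : EuclideanSpace ℝ ι => c * y n * ‖y‖ ^ a) h1]
  simp [EuclideanSpace.inner_single_right, PiLp.single_apply]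
  split_ifs <;> ring

/-- The flux `A∇u` of `u = c x_n ‖x‖ ^ (γ - 1)`. -/
theorem Amat_flux {N : ℕ} {x : EuclideanSpace ℝ (Fin N)} (hx : x ≠ 0) (n i : Fin N)
    (c k γ : ℝ) :
    ∑ j, Amat k x i j * fderiv ℝ (fun y : EuclideanSpace ℝ (Fin N) =>
        c * y n * ‖y‖ ^ (γ - 1)) x (EuclideanSpace.single j 1)
      = (if n = i then c * k else 0) * ‖x‖ ^ (γ - 1)
        + c * (γ - k) * (x n * x i * ‖x‖ ^ (γ - 3)) := by
  have hpos : 0 < ‖x‖ := norm_pos_iff.mpr hx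
  have hr : ‖x‖ ^ (γ - 1) = ‖x‖ ^ (γ - 3) * ‖x‖ ^ 2 := by
    rw [← Real.rpow_add_natCast hpos.ne']; congr 1; push_cast; ring
  have hsq : ∑ j, x j * x j = ‖x‖ ^ 2 := by
    rw [EuclideanSpace.real_norm_sq_eq]; exact Finset.sum_congr rfl fun j _ => by ring
  simp_rw [fderiv_coord_mul_norm_rpow hx, show γ - 1 - 2 = γ - 3 by ring, hr, Amat,
    Matrix.of_apply]
  have expand : ∀ j : Fin N,
      (k * (if i = j then 1 else 0) + (1 - k) * (x i * x j) / ‖x‖ ^ 2) *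
        (c * ((if n = j then ‖x‖ ^ (γ - 3) * ‖x‖ ^ 2 else 0)
          + (γ - 1) * ‖x‖ ^ (γ - 3) * x n * x j))
      = (if i = j then k * (c * ((if n = j then ‖x‖ ^ (γ - 3) * ‖x‖ ^ 2 else 0)
          + (γ - 1) * ‖x‖ ^ (γ - 3) * x n * x j)) else 0)
        + (if n = j then (1 - k) * x i * x j * c * ‖x‖ ^ (γ - 3) else 0)
        + (1 - k) * x i * c * (γ - 1) * ‖x‖ ^ (γ - 3) * x n / ‖x‖ ^ 2 * (x j * x j) := by
    intro j
    split_ifs <;> field_simp <;> ring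
  simp_rw [expand, Finset.sum_add_distrib, ← Finset.mul_sum, hsq,
    Finset.sum_ite_eq, Finset.mem_univ, if_true]
  split_ifs <;> field_simp <;> ring

/-- The partial derivatives of the flux. -/
theorem fderiv_flux {N : ℕ} {x : EuclideanSpace ℝ (Fin N)} (hx : x ≠ 0) (n i : Fin N)
    (d m γ : ℝ) :
    fderiv ℝ (fun y : EuclideanSpace ℝ (Fin N) => d * ‖y‖ ^ (γ - 1)
        + m * (y n * y i * ‖y‖ ^ (γ - 3))) x (EuclideanSpace.single i 1)
      = d * ((γ - 1) * ‖x‖ ^ (γ - 3) * x i)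
        + m * ((if n = i then x i * ‖x‖ ^ (γ - 3) else 0) + x n * ‖x‖ ^ (γ - 3)
          + x n * (γ - 3) * ‖x‖ ^ (γ - 5) * (x i * x i)) := by
  have hp : ∀ l, HasFDerivAt (fun y : EuclideanSpace ℝ (Fin N) => y l)
      (EuclideanSpace.proj l : EuclideanSpace ℝ (Fin N) →L[ℝ] ℝ) x :=
    fun l => (EuclideanSpace.proj l : EuclideanSpace ℝ (Fin N) →L[ℝ] ℝ).hasFDerivAt
  have h := ((hasFDerivAt_norm_rpow_of_ne_zero hx (γ - 1)).const_mul d).add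
    ((((hp n).mul (hp i)).mul (hasFDerivAt_norm_rpow_of_ne_zero hx (γ - 3))).const_mul m)
  rw [HasFDerivAt.fderiv (f := fun y : EuclideanSpace ℝ (Fin N) => d * ‖y‖ ^ (γ - 1)
        + m * (y n * y i * ‖y‖ ^ (γ - 3))) h, show γ - 1 - 2 = γ - 3 by ring,
    show γ - 3 - 2 = γ - 5 by ring]
  simp [EuclideanSpace.inner_single_right, PiLp.single_apply]
  split_ifs <;> ring

/-- The divergence `div(A∇u)` of `u = c x_n ‖x‖ ^ (γ - 1)` away from the origin. -/
theorem divAgrad_Amat_coord_mul_norm_rpow {N : ℕ} {x : EuclideanSpace ℝ (Fin N)}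
    (hx : x ≠ 0) (n : Fin N) (c k γ : ℝ) :
    divAgrad (Amat k) (fun y => c * y n * ‖y‖ ^ (γ - 1)) x
      = c * (γ * (γ + N - 2) - k * (N - 1)) * x n * ‖x‖ ^ (γ - 3) := by
  have hpos : 0 < ‖x‖ := norm_pos_iff.mpr hx
  have hr : ‖x‖ ^ (γ - 3) = ‖x‖ ^ (γ - 5) * ‖x‖ ^ 2 := by
    rw [← Real.rpow_add_natCast hpos.ne']; congr 1; push_cast; ring
  have hsq : ∑ j, x j * x j = ‖x‖ ^ 2 := by
    rw [EuclideanSpace.real_norm_sq_eq]; exact Finset.sum_congr rfl fun j _ => by ring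
  have hflux : ∀ i : Fin N, (fun y => ∑ j, Amat k y i j *
        fderiv ℝ (fun y : EuclideanSpace ℝ (Fin N) => c * y n * ‖y‖ ^ (γ - 1)) y
          (EuclideanSpace.single j 1)) =ᶠ[nhds x]
      fun y => (if n = i then c * k else 0) * ‖y‖ ^ (γ - 1)
        + c * (γ - k) * (y n * y i * ‖y‖ ^ (γ - 3)) := fun i => by
    filter_upwards [isOpen_ne.mem_nhds hx] with y hy using Amat_flux hy n i c k γ
  unfold divAgrad
  simp_rw [(hflux _).fderiv_eq, fderiv_flux hx]
  simp_rw [Finset.sum_add_distrib, ite_mul, zero_mul, ← Finset.mul_sum,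
    Finset.sum_add_distrib, ← Finset.mul_sum, hsq,
    Finset.sum_ite_eq, Finset.mem_univ, if_true, Finset.sum_const, Finset.card_univ,
    Fintype.card_fin, nsmul_eq_mul, hr]
  ring

/-- Since `γ (q - 1) = -2` and `t ≤ r`, the power `(c t r ^ (γ - 1)) ^ q` is controlled by
`c t r ^ (γ - 3)`. -/
theorem rpow_coord_mul_norm_le {c t r γ q D : ℝ} (hc : 0 < c) (ht : 0 < t) (htr : t ≤ r)
    (hq : 1 < q) (hγ : γ * (q - 1) = -2) (hD : c ^ (q - 1) ≤ D) :
    (c * t * r ^ (γ - 1)) ^ q ≤ c * D * t * r ^ (γ - 3) := by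
  have hr : 0 < r := ht.trans_le htr
  have hu : 0 < c * t * r ^ (γ - 1) := by positivity
  have hsplit : (c * t * r ^ (γ - 1)) ^ q
      = (c * t * r ^ (γ - 1)) ^ (q - 1) * (c * t * r ^ (γ - 1)) := by
    rw [← Real.rpow_add_one hu.ne']; congr 1; ring
  have hle : (c * t * r ^ (γ - 1)) ^ (q - 1) ≤ D * r ^ (-2 : ℝ) := by
    calc (c * t * r ^ (γ - 1)) ^ (q - 1) ≤ (c * r ^ γ) ^ (q - 1) := by
          refine Real.rpow_le_rpow hu.le ?_ (by linarith)
          have : r ^ γ = r * r ^ (γ - 1) := by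
            rw [mul_comm, ← Real.rpow_add_one hr.ne']; congr 1; ring
          rw [this, mul_assoc]
          gcongr
      _ = c ^ (q - 1) * r ^ (-2 : ℝ) := by
          rw [Real.mul_rpow hc.le (by positivity), ← Real.rpow_mul hr.le, hγ]
      _ ≤ D * r ^ (-2 : ℝ) := by gcongr
  have hexp : r ^ (γ - 3) = r ^ (-2 : ℝ) * r ^ (γ - 1) := by
    rw [← Real.rpow_add hr]; congr 1; ring
  rw [hsplit, hexp]
  calc _ ≤ D * r ^ (-2 : ℝ) * (c * t * r ^ (γ - 1)) := by gcongr
    _ = _ := by ring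

/-- Existence half of Theorem 1.4 on the half-space cone: for `p ∈ (1, N/(N-2))`,
`α = -2/(p-1)`, `k = α(α+N-2)/(N-1)`, and any `q > p`, the function
`u(x) = c x_N ‖x‖^{γ-1}` with `γ = -2/(q-1)` and small `c > 0` is a positive
supersolution of `-div(A_p∇u) = u^q` on `C₊`. -/
theorem Ap_supersolution_above_critical
    (N : ℕ) (hN : 3 ≤ N) (p : ℝ) (hp : p ∈ Set.Ioo 1 ((N : ℝ) / ((N : ℝ) - 2)))
    (α k : ℝ) (hα : α = -2 / (p - 1)) (hk : k = α * (α + (N : ℝ) - 2) / ((N : ℝ) - 1)) :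
    (α < 2 - (N : ℝ) ∧ 0 < k) ∧
    ∀ q : ℝ, p < q → ∀ γ : ℝ, γ = -2 / (q - 1) →
      (α < γ ∧ γ < 0) ∧
      0 < α * (α + (N : ℝ) - 2) - γ * (γ + (N : ℝ) - 2) ∧
      ∀ c : ℝ, 0 < c →
        c ^ (q - 1) ≤ α * (α + (N : ℝ) - 2) - γ * (γ + (N : ℝ) - 2) →
        ContDiffOn ℝ 2 (fun x : EuclideanSpace ℝ (Fin N) => c * lastCoord x * ‖x‖ ^ (γ - 1))
          {x | 0 < lastCoord x} ∧
        (∀ x : EuclideanSpace ℝ (Fin N), 0 < lastCoord x →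
          0 < c * lastCoord x * ‖x‖ ^ (γ - 1)) ∧
        (∀ x : EuclideanSpace ℝ (Fin N), 0 < lastCoord x →
          -divAgrad (Amat k) (fun y => c * lastCoord y * ‖y‖ ^ (γ - 1)) x
              = c * (α * (α + (N : ℝ) - 2) - γ * (γ + (N : ℝ) - 2)) * lastCoord x
                  * ‖x‖ ^ (γ - 3) ∧
          (c * lastCoord x * ‖x‖ ^ (γ - 1)) ^ q
              ≤ c * (α * (α + (N : ℝ) - 2) - γ * (γ + (N : ℝ) - 2)) * lastCoord x
                  * ‖x‖ ^ (γ - 3) ∧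
          0 < (c * lastCoord x * ‖x‖ ^ (γ - 1)) ^ q) := by
  have hN' : (3 : ℝ) ≤ N := by exact_mod_cast hN
  obtain ⟨hp1, hp2⟩ := hp
  have hαN : α < 2 - (N : ℝ) := by
    rw [lt_div_iff₀ (by linarith)] at hp2
    rw [hα, div_lt_iff₀ (by linarith)]
    linarith
  refine ⟨⟨hαN, ?_⟩, ?_⟩
  · rw [hk]
    exact div_pos (mul_pos_of_neg_of_neg (by linarith) (by linarith)) (by linarith)
  intro q hq γ hγ
  have hαγ : α < γ := by
    rw [hα, hγ, neg_div, neg_div, neg_lt_neg_iff]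
    exact div_lt_div_of_pos_left two_pos (by linarith) (by linarith)
  have hγ0 : γ < 0 := by
    rw [hγ]; exact div_neg_of_neg_of_pos (by norm_num) (by linarith)
  have hγq : γ * (q - 1) = -2 := by
    rw [hγ]; exact div_mul_cancel₀ _ (by linarith)
  refine ⟨⟨hαγ, hγ0⟩, by nlinarith, ?_⟩
  intro c hc hcD
  have hlast : ∀ y : EuclideanSpace ℝ (Fin N),
      lastCoord y = y ⟨N - 1, Nat.sub_lt (by omega) Nat.one_pos⟩ :=
    fun y => dif_pos (by omega)
  simp only [hlast]
  set n : Fin N := ⟨N - 1, Nat.sub_lt (by omega) Nat.one_pos⟩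
  have hne : ∀ x : EuclideanSpace ℝ (Fin N), 0 < x n → x ≠ 0 := by
    rintro x hx rfl
    simp at hx
  have hupos : ∀ x : EuclideanSpace ℝ (Fin N), 0 < x n → 0 < c * x n * ‖x‖ ^ (γ - 1) :=
    fun x hx => by have := norm_pos_iff.mpr (hne x hx); positivity
  refine ⟨fun x hx => ?_, hupos, fun x hx => ⟨?_, ?_, Real.rpow_pos_of_pos (hupos x hx) q⟩⟩
  · have hp : ContDiffAt ℝ 2 (fun y : EuclideanSpace ℝ (Fin N) => y n) x :=
      (EuclideanSpace.proj n : EuclideanSpace ℝ (Fin N) →L[ℝ] ℝ).contDiff.contDiffAt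
    exact ((contDiffAt_const.mul hp).mul ((contDiffAt_norm ℝ (hne x hx)).rpow_const_of_ne
      (norm_ne_zero_iff.mpr (hne x hx)))).contDiffWithinAt
  · rw [divAgrad_Amat_coord_mul_norm_rpow (hne x hx)]
    have hkN : k * ((N : ℝ) - 1) = α * (α + N - 2) := by
      rw [hk]; exact div_mul_cancel₀ _ (by linarith)
    rw [hkN]
    ring
  · exact rpow_coord_mul_norm_le hc hx
      ((le_abs_self _).trans (PiLp.norm_apply_le x n)) (by linarith) hγq hcD
end
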